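/- Let G be a graph on vertex set {1,...,n}, let {V₁, V₂} be highly regular for G, and assume the induced subgraph G[V₁ ∪ V₂] is NOT regular. Then there exists a closed bounded interval [a, b] ⊂ ℝ such that: if c ∈ [a, b], then gKKT_c(G) ∩ [x^{V₁}, x^{V₂}] = {x^{V₁}, x^{V₂}}; and if c ∉ [a, b], then gKKT_c(G) ∩ [x^{V₁}, x^{V₂}] = {x^{V₁}, x^{V₂}, x_c} for some point x_c ∈ Δₙ depending on c that is not a characteristic vector, where [x^{V₁}, x^{V₂}] denotes the convex hull of x^{V₁} and x^{V₂}. -/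

import Mathlib

open Matrix BigOperators

/-- The characteristic vector of a non-empty set `S` of vertices: `1/|S|` on `S`, `0` elsewhere. -/
noncomputable def charVec {n : ℕ} (S : Finset (Fin n)) : Fin n → ℝ :=
  fun i => if i ∈ S then ((S.card : ℝ))⁻¹ else 0

/-- The set of generalized KKT points of the parametric Motzkin–Straus program. -/
def gKKT {n : ℕ} (A : Matrix (Fin n) (Fin n) ℝ) (c : ℝ) : Set (Fin n → ℝ) :=
  {x | x ∈ stdSimplex ℝ (Fin n) ∧
    ∃ lam : ℝ, ∀ i, x i ≠ 0 → ((A + c • 1) *ᵥ x) i = lam}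

/-- `e_G(S₁,S₂)`: the number of ordered pairs of adjacent vertices in `S₁ × S₂`. -/
noncomputable def eG {n : ℕ} (A : Matrix (Fin n) (Fin n) ℝ) (S₁ S₂ : Finset (Fin n)) : ℕ :=
  ((S₁ ×ˢ S₂).filter (fun p => A p.1 p.2 = 1)).card

/-- The edge density `d_G(S₁,S₂) = e_G(S₁,S₂)/(|S₁||S₂|)`. -/
noncomputable def dG {n : ℕ} (A : Matrix (Fin n) (Fin n) ℝ) (S₁ S₂ : Finset (Fin n)) : ℝ :=
  (eG A S₁ S₂ : ℝ) / ((S₁.card : ℝ) * (S₂.card : ℝ))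

lemma eG_singleton_left {n : ℕ} (A : Matrix (Fin n) (Fin n) ℝ) (i : Fin n)
    (S : Finset (Fin n)) : eG A {i} S = (S.filter (fun j => A i j = 1)).card := by
  rw [eG, Finset.singleton_product, Finset.filter_map, Finset.card_map]
  rfl

/-- Multiplying the adjacency matrix by a characteristic vector gives edge densities. -/
lemma mulVec_charVec {n : ℕ} {A : Matrix (Fin n) (Fin n) ℝ}
    (h01 : ∀ i j, A i j = 0 ∨ A i j = 1) (S : Finset (Fin n)) (i : Fin n) :
    (A *ᵥ charVec S) i = dG A {i} S := by
  have hterm : ∀ j, A i j * charVec S j =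
      if j ∈ S then (if A i j = 1 then (S.card : ℝ)⁻¹ else 0) else 0 := by
    intro j
    rcases h01 i j with h | h <;> simp [charVec, h]
  simp only [mulVec, dotProduct, hterm, dG, eG_singleton_left]
  rw [Finset.sum_ite_mem, Finset.univ_inter, ← Finset.sum_filter]
  simp [div_eq_mul_inv]

lemma card_filter_eq_card_mul_dG {n : ℕ} (A : Matrix (Fin n) (Fin n) ℝ)
    {S : Finset (Fin n)} (hS : S.Nonempty) (i : Fin n) :
    ((S.filter (fun j => A i j = 1)).card : ℝ) = S.card * dG A {i} S := by
  have : (S.card : ℝ) ≠ 0 := by exact_mod_cast hS.card_pos.ne'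
  rw [dG, eG_singleton_left]
  field_simp
  simp

lemma dG_comm {n : ℕ} {A : Matrix (Fin n) (Fin n) ℝ} (hsymm : A.IsSymm)
    (S T : Finset (Fin n)) : dG A S T = dG A T S := by
  have : eG A S T = eG A T S := by
    refine Finset.card_bij' (fun p _ => p.swap) (fun p _ => p.swap) ?_ ?_ ?_ ?_
    · rintro ⟨i, j⟩ h
      simpa [and_comm, hsymm.apply] using h
    · rintro ⟨i, j⟩ h
      simpa [and_comm, hsymm.apply] using h
    · simp
    · simp
  rw [dG, dG, this, mul_comm]

lemma charVec_mem_stdSimplex {n : ℕ} {S : Finset (Fin n)} (hS : S.Nonempty) :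
    charVec S ∈ stdSimplex ℝ (Fin n) := by
  refine ⟨fun i => ?_, ?_⟩
  · simp only [charVec]
    split_ifs <;> positivity
  · have : (S.card : ℝ) ≠ 0 := by exact_mod_cast hS.card_pos.ne'
    simp [charVec, Finset.sum_ite_mem, this]

/-- Nonzero entries of a characteristic vector coincide. -/
lemma charVec_eq_of_ne_zero {n : ℕ} {S : Finset (Fin n)} {i j : Fin n}
    (hi : charVec S i ≠ 0) (hj : charVec S j ≠ 0) : charVec S i = charVec S j := by
  have hi' : i ∈ S := by by_contra h; simp [charVec, h] at hi
  have hj' : j ∈ S := by by_contra h; simp [charVec, h] at hj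
  simp [charVec, hi', hj']

/-- The generalized KKT condition on the segment between the characteristic vectors of a highly
regular pair of vertex sets with densities `p₁`, `p`, `p₂`. -/
lemma smul_charVec_add_mem_gKKT_iff {n : ℕ} {A : Matrix (Fin n) (Fin n) ℝ}
    (h01 : ∀ i j, A i j = 0 ∨ A i j = 1)
    {V₁ V₂ : Finset (Fin n)} (hn1 : V₁.Nonempty) (hn2 : V₂.Nonempty)
    (hdisj : Disjoint V₁ V₂) {p₁ p p₂ : ℝ}
    (h11 : ∀ i ∈ V₁, dG A {i} V₁ = p₁) (h12 : ∀ i ∈ V₁, dG A {i} V₂ = p)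
    (h21 : ∀ i ∈ V₂, dG A {i} V₁ = p) (h22 : ∀ i ∈ V₂, dG A {i} V₂ = p₂)
    (c : ℝ) {s t : ℝ} (hs : 0 ≤ s) (ht : 0 ≤ t) (hst : s + t = 1) :
    s • charVec V₁ + t • charVec V₂ ∈ gKKT A c ↔
      s = 0 ∨ t = 0 ∨ s * (p₁ - p + c * (V₁.card : ℝ)⁻¹) = t * (p₂ - p + c * (V₂.card : ℝ)⁻¹) := by
  have hk1 : (V₁.card : ℝ) ≠ 0 := by exact_mod_cast hn1.card_pos.ne'
  have hk2 : (V₂.card : ℝ) ≠ 0 := by exact_mod_cast hn2.card_pos.ne'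
  have hx1 : ∀ i ∈ V₁, (s • charVec V₁ + t • charVec V₂) i = s * (V₁.card : ℝ)⁻¹ := by
    intro i hi
    simp [charVec, hi, Finset.disjoint_left.1 hdisj hi]
  have hx2 : ∀ i ∈ V₂, (s • charVec V₁ + t • charVec V₂) i = t * (V₂.card : ℝ)⁻¹ := by
    intro i hi
    simp [charVec, hi, Finset.disjoint_right.1 hdisj hi]
  have hx0 : ∀ i, i ∉ V₁ → i ∉ V₂ → (s • charVec V₁ + t • charVec V₂) i = 0 := by
    intro i h1 h2
    simp [charVec, h1, h2]
  have hmul : ∀ i, ((A + c • 1) *ᵥ (s • charVec V₁ + t • charVec V₂)) i =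
      s * dG A {i} V₁ + t * dG A {i} V₂ + c * (s • charVec V₁ + t • charVec V₂) i := by
    intro i
    rw [add_mulVec, smul_mulVec, one_mulVec, mulVec_add, mulVec_smul, mulVec_smul]
    simp only [Pi.add_apply, Pi.smul_apply, smul_eq_mul, mulVec_charVec h01]
  have hy1 : ∀ i ∈ V₁, ((A + c • 1) *ᵥ (s • charVec V₁ + t • charVec V₂)) i =
      s * p₁ + t * p + c * (s * (V₁.card : ℝ)⁻¹) := by
    intro i hi
    rw [hmul, hx1 i hi, h11 i hi, h12 i hi]
  have hy2 : ∀ i ∈ V₂, ((A + c • 1) *ᵥ (s • charVec V₁ + t • charVec V₂)) i =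
      s * p + t * p₂ + c * (t * (V₂.card : ℝ)⁻¹) := by
    intro i hi
    rw [hmul, hx2 i hi, h21 i hi, h22 i hi]
  constructor
  · rintro ⟨-, lam, hlam⟩
    by_cases hs0 : s = 0
    · exact Or.inl hs0
    by_cases ht0 : t = 0
    · exact Or.inr (Or.inl ht0)
    obtain ⟨i, hi⟩ := hn1
    obtain ⟨j, hj⟩ := hn2
    have e1 := hlam i (by rw [hx1 i hi]; positivity)
    have e2 := hlam j (by rw [hx2 j hj]; positivity)
    rw [hy1 i hi] at e1
    rw [hy2 j hj] at e2
    right; right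
    linarith
  · intro h
    refine ⟨(convex_stdSimplex ℝ (Fin n)) (charVec_mem_stdSimplex hn1)
      (charVec_mem_stdSimplex hn2) hs ht hst, ?_⟩
    by_cases hs0 : s = 0
    · refine ⟨s * p + t * p₂ + c * (t * (V₂.card : ℝ)⁻¹), fun i hi => ?_⟩
      by_cases h2 : i ∈ V₂
      · exact hy2 i h2
      · by_cases h1 : i ∈ V₁
        · exact absurd (by rw [hx1 i h1, hs0, zero_mul]) hi
        · exact absurd (hx0 i h1 h2) hi
    refine ⟨s * p₁ + t * p + c * (s * (V₁.card : ℝ)⁻¹), fun i hi => ?_⟩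
    by_cases h1 : i ∈ V₁
    · exact hy1 i h1
    by_cases h2 : i ∈ V₂
    · rcases h with h | h | h
      · exact absurd h hs0
      · exact absurd (by rw [hx2 i h2, h, zero_mul]) hi
      · rw [hy2 i h2]
        linarith
    · exact absurd (hx0 i h1 h2) hi

/-- If the two slopes do not have the same strict sign and do not both vanish, the balance
equation has no positive solution. -/
lemma false_of_mul_eq_mul {s t α β : ℝ} (hs : 0 < s) (ht : 0 < t) (h : s * α = t * β)
    (hαβ : α * β ≤ 0) (hne : ¬ (α = 0 ∧ β = 0)) : False := by
  have h1 : s * α ^ 2 = t * (α * β) := by linear_combination α * h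
  have hα : α = 0 := by
    by_contra hα
    have : 0 < s * α ^ 2 := by positivity
    nlinarith
  subst hα
  refine hne ⟨rfl, ?_⟩
  simpa [ht.ne'] using h.symm

/-- Let `{V₁, V₂}` be highly regular for `G` with `G[V₁ ∪ V₂]` NOT regular.
Then there is a closed bounded interval `[a, b]` such that for `c ∈ [a, b]` the generalized
KKT points on the segment `[x^{V₁}, x^{V₂}]` are exactly its endpoints, while for `c ∉ [a, b]`
there is exactly one further generalized KKT point `x_c` on the segment, and `x_c` is not a
characteristic vector. -/
theorem gkkt_on_segment_of_not_regular
    (n : ℕ) (A : Matrix (Fin n) (Fin n) ℝ)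
    (hsymm : A.IsSymm)
    (h01 : ∀ i j, A i j = 0 ∨ A i j = 1)
    (hdiag : ∀ i, A i i = 0)
    (V₁ V₂ : Finset (Fin n)) (hn1 : V₁.Nonempty) (hn2 : V₂.Nonempty)
    (hdisj : Disjoint V₁ V₂)
    (h11 : ∀ i ∈ V₁, dG A V₁ V₁ = dG A {i} V₁)
    (h12 : ∀ i ∈ V₁, dG A V₁ V₂ = dG A {i} V₂)
    (h21 : ∀ i ∈ V₂, dG A V₂ V₁ = dG A {i} V₁)
    (h22 : ∀ i ∈ V₂, dG A V₂ V₂ = dG A {i} V₂)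
    (hnotreg : ¬ ∃ d : ℕ, ∀ i ∈ V₁ ∪ V₂, ((V₁ ∪ V₂).filter (fun j => A i j = 1)).card = d) :
    ∃ a b : ℝ, a ≤ b ∧ ∀ c : ℝ,
      (c ∈ Set.Icc a b → gKKT A c ∩ segment ℝ (charVec V₁) (charVec V₂) =
        {charVec V₁, charVec V₂}) ∧
      (c ∉ Set.Icc a b → ∃ xc ∈ stdSimplex ℝ (Fin n),
        (¬ ∃ S : Finset (Fin n), S.Nonempty ∧ xc = charVec S) ∧
        gKKT A c ∩ segment ℝ (charVec V₁) (charVec V₂) =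
          {charVec V₁, charVec V₂, xc}) := by
  have hk1 : (0 : ℝ) < V₁.card := by exact_mod_cast hn1.card_pos
  have hk2 : (0 : ℝ) < V₂.card := by exact_mod_cast hn2.card_pos
  set k₁ := (V₁.card : ℝ) with hk1def
  set k₂ := (V₂.card : ℝ) with hk2def
  set p₁ := dG A V₁ V₁
  set p := dG A V₁ V₂
  set p₂ := dG A V₂ V₂
  replace h21 : ∀ i ∈ V₂, dG A {i} V₁ = p := fun i hi => by
    rw [← h21 i hi, dG_comm hsymm]
  have hr : k₁ * (p - p₁) ≠ k₂ * (p - p₂) := by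
    intro h
    have hdeg : ∀ i, (((V₁ ∪ V₂).filter (fun j => A i j = 1)).card : ℝ) =
        k₁ * dG A {i} V₁ + k₂ * dG A {i} V₂ := by
      intro i
      rw [Finset.filter_union, Finset.card_union_of_disjoint
        (Finset.disjoint_filter_filter hdisj), Nat.cast_add,
        card_filter_eq_card_mul_dG A hn1, card_filter_eq_card_mul_dG A hn2]
    have hconst : ∀ i ∈ V₁ ∪ V₂,
        (((V₁ ∪ V₂).filter (fun j => A i j = 1)).card : ℝ) = k₁ * p₁ + k₂ * p := by
      intro i hi
      rw [hdeg]
      rcases Finset.mem_union.1 hi with hi | hi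
      · rw [← h11 i hi, ← h12 i hi]
      · rw [h21 i hi, ← h22 i hi]
        linarith
    obtain ⟨i₀, hi₀⟩ := hn1
    refine hnotreg ⟨((V₁ ∪ V₂).filter (fun j => A i₀ j = 1)).card, fun i hi => ?_⟩
    have e := (hconst i hi).trans (hconst i₀ (Finset.mem_union_left _ hi₀)).symm
    exact_mod_cast e
  have key := fun (c s t : ℝ) (hs : 0 ≤ s) (ht : 0 ≤ t) (hst : s + t = 1) =>
    smul_charVec_add_mem_gKKT_iff h01 hn1 hn2 hdisj (fun i hi => (h11 i hi).symm)
      (fun i hi => (h12 i hi).symm) h21 (fun i hi => (h22 i hi).symm) c hs ht hst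
  rw [← hk1def, ← hk2def] at key
  set r₁ := k₁ * (p - p₁) with hr1
  set r₂ := k₂ * (p - p₂) with hr2
  have hα : ∀ c, p₁ - p + c * k₁⁻¹ = (c - r₁) * k₁⁻¹ := fun c => by
    rw [hr1]; field_simp; ring
  have hβ : ∀ c, p₂ - p + c * k₂⁻¹ = (c - r₂) * k₂⁻¹ := fun c => by
    rw [hr2]; field_simp; ring
  simp only [hα, hβ] at key
  have hend1 : ∀ c, charVec V₁ ∈ gKKT A c := fun c => by
    simpa using (key c 1 0 zero_le_one le_rfl (by norm_num)).2 (by simp)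
  have hend2 : ∀ c, charVec V₂ ∈ gKKT A c := fun c => by
    simpa using (key c 0 1 le_rfl zero_le_one (by norm_num)).2 (by simp)
  refine ⟨min r₁ r₂, max r₁ r₂, min_le_max, fun c => ⟨fun hc => ?_, fun hc => ?_⟩⟩
  · have hsign : (c - r₁) * (c - r₂) ≤ 0 := by
      obtain ⟨hc1, hc2⟩ := hc
      rcases le_total r₁ r₂ with h | h
      · rw [min_eq_left h] at hc1
        rw [max_eq_right h] at hc2
        exact mul_nonpos_of_nonneg_of_nonpos (by linarith) (by linarith)
      · rw [min_eq_right h] at hc1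
        rw [max_eq_left h] at hc2
        exact mul_nonpos_of_nonpos_of_nonneg (by linarith) (by linarith)
    apply Set.Subset.antisymm
    · rintro x ⟨hx, s, t, hs, ht, hst, rfl⟩
      rcases (key c s t hs ht hst).1 hx with h | h | h
      · obtain rfl : t = 1 := by linarith
        simp [h]
      · obtain rfl : s = 1 := by linarith
        simp [h]
      · rcases hs.eq_or_lt with h0 | hs
        · obtain rfl : t = 1 := by linarith
          simp [← h0]
        rcases ht.eq_or_lt with h0 | ht
        · obtain rfl : s = 1 := by linarith
          simp [← h0]
        refine (false_of_mul_eq_mul hs ht h ?_ ?_).elim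
        · rw [mul_mul_mul_comm]
          exact mul_nonpos_of_nonpos_of_nonneg hsign (by positivity)
        · rintro ⟨h1, h2⟩
          simp only [mul_eq_zero, inv_eq_zero, hk1.ne', hk2.ne', or_false] at h1 h2
          exact hr (by linarith)
    · rintro x (rfl | rfl)
      · exact ⟨hend1 c, left_mem_segment ℝ _ _⟩
      · exact ⟨hend2 c, right_mem_segment ℝ _ _⟩
  · have hsign : 0 < (c - r₁) * (c - r₂) := by
      rw [Set.mem_Icc, not_and_or, not_le, not_le, lt_min_iff, max_lt_iff] at hc
      rcases hc with ⟨h1, h2⟩ | ⟨h1, h2⟩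
      · exact mul_pos_of_neg_of_neg (by linarith) (by linarith)
      · exact mul_pos (by linarith) (by linarith)
    set α := (c - r₁) * k₁⁻¹ with hαdef
    set β := (c - r₂) * k₂⁻¹ with hβdef
    have hαβ : 0 < α * β := by
      rw [hαdef, hβdef, mul_mul_mul_comm]
      positivity
    have hsum : α + β ≠ 0 := by
      intro h
      have : β = -α := by linarith
      rw [this] at hαβ
      nlinarith [sq_nonneg α]
    have hs₀ : 0 < β / (α + β) := by
      have : β / (α + β) = (α * β + β ^ 2) / (α + β) ^ 2 := by field_simp
      rw [this]
      positivity
    have ht₀ : 0 < α / (α + β) := by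
      have : α / (α + β) = (α * β + α ^ 2) / (α + β) ^ 2 := by field_simp; ring
      rw [this]
      positivity
    have hst₀ : β / (α + β) + α / (α + β) = 1 := by field_simp; ring
    have hbal : β / (α + β) * α = α / (α + β) * β := by ring
    have hxc : (β / (α + β)) • charVec V₁ + (α / (α + β)) • charVec V₂ ∈ gKKT A c :=
      (key c _ _ hs₀.le ht₀.le hst₀).2 (Or.inr (Or.inr hbal))
    refine ⟨_, hxc.1, ?_, ?_⟩
    · rintro ⟨S, -, hS⟩
      obtain ⟨i, hi⟩ := hn1
      obtain ⟨j, hj⟩ := hn2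
      have e1 : β / (α + β) * k₁⁻¹ = charVec S i := by
        rw [← hS]
        simp [charVec, hi, Finset.disjoint_left.1 hdisj hi, k₁]
      have e2 : α / (α + β) * k₂⁻¹ = charVec S j := by
        rw [← hS]
        simp [charVec, hj, Finset.disjoint_right.1 hdisj hj, k₂]
      have e := charVec_eq_of_ne_zero (S := S) (i := i) (j := j)
        (by rw [← e1]; positivity) (by rw [← e2]; positivity)
      rw [← e1, ← e2] at e
      have hpos : α / (α + β) * k₂⁻¹ ≠ 0 := by positivity
      apply hr
      have : α / (α + β) * k₂⁻¹ * (r₁ - r₂) = 0 := by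
        linear_combination (c - r₁) * e - hbal + β / (α + β) * hαdef - α / (α + β) * hβdef
      rcases mul_eq_zero.1 this with h | h
      · exact absurd h hpos
      · linarith
    · apply Set.Subset.antisymm
      · rintro x ⟨hx, s, t, hs, ht, hst, rfl⟩
        rcases (key c s t hs ht hst).1 hx with h | h | h
        · obtain rfl : t = 1 := by linarith
          simp [h]
        · obtain rfl : s = 1 := by linarith
          simp [h]
        · have hs' : s = β / (α + β) := by
            rw [eq_div_iff hsum]
            linear_combination h + β * hst
          have ht' : t = α / (α + β) := by linarith
          simp [← hs', ← ht']
      · rintro x (rfl | rfl | rfl)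
        · exact ⟨hend1 c, left_mem_segment ℝ _ _⟩
        · exact ⟨hend2 c, right_mem_segment ℝ _ _⟩
        · exact ⟨hxc, _, _, hs₀.le, ht₀.le, hst₀, rfl⟩
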